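/- Let N ≥ 1, Ω ⊂ ℝ^N a smooth bounded domain, and let f, g be nondecreasing C¹ functions. Let (u,v) ∈ C²(Ω̄) × C²(Ω̄) be a stable solution of the system −Δu = g(v), −Δv = f(u) in Ω with u = v = 0 on ∂Ω. Then for every φ ∈ C_c¹(Ω), ∫_Ω √(f′(u) g′(v)) φ² dx ≤ ∫_Ω |∇φ|² dx. -/

import Mathlib

open MeasureTheory Metric Set Filter Topology

noncomputable section

/-- Euclidean space `ℝ^N`. -/
abbrev Euc (N : ℕ) := EuclideanSpace ℝ (Fin N)

/-- Second derivative of `u` at `x` in the `i`-th coordinate direction. -/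
noncomputable def secondDerivCoord {N : ℕ} (u : Euc N → ℝ) (i : Fin N) (x : Euc N) : ℝ :=
  deriv (fun t : ℝ => fderiv ℝ u (x + t • (EuclideanSpace.single i (1:ℝ)))
    (EuclideanSpace.single i (1:ℝ))) 0

/-- The Laplacian `Δu = ∑ ∂²u/∂xᵢ²`. -/
noncomputable def lap {N : ℕ} (u : Euc N → ℝ) (x : Euc N) : ℝ :=
  ∑ i : Fin N, secondDerivCoord u i x

/-- A (smooth) bounded domain: open, bounded and nonempty. -/
def IsBddDomain {N : ℕ} (Ω : Set (Euc N)) : Prop :=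
  IsOpen Ω ∧ Bornology.IsBounded Ω ∧ Ω.Nonempty

/-- Hypothesis (H): `f ∈ C^α(Ω̄)` for some `α ∈ (0,1]`, `0 ≤ f ≤ 1`, and `f > 0`
on a subset of `Ω` of positive measure. -/
def HypH {N : ℕ} (Ω : Set (Euc N)) (f : Euc N → ℝ) : Prop :=
  (∃ α : NNReal, 0 < α ∧ α ≤ 1 ∧ ∃ C : NNReal, HolderOnWith C α f (closure Ω)) ∧
  (∀ x ∈ closure Ω, 0 ≤ f x ∧ f x ≤ 1) ∧
  0 < volume {x ∈ Ω | 0 < f x}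

/-- A classical solution `(u,v)` of the system `S_{λ,μ}` on `Ω`:
`u, v ∈ C²(Ω) ∩ C(Ω̄)`, `0 ≤ u, v < 1` in `Ω`, `u = v = 0` on `∂Ω`,
`-Δu = λ f(x)/(1-v)²` and `-Δv = μ g(x)/(1-u)²` in `Ω`. -/
structure IsClassicalSolution {N : ℕ} (Ω : Set (Euc N)) (f g : Euc N → ℝ)
    (lam mu : ℝ) (u v : Euc N → ℝ) : Prop where
  smooth_u : ContDiffOn ℝ 2 u Ω
  smooth_v : ContDiffOn ℝ 2 v Ω
  cont_u : ContinuousOn u (closure Ω)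
  cont_v : ContinuousOn v (closure Ω)
  range_u : ∀ x ∈ Ω, 0 ≤ u x ∧ u x < 1
  range_v : ∀ x ∈ Ω, 0 ≤ v x ∧ v x < 1
  bdry_u : ∀ x ∈ frontier Ω, u x = 0
  bdry_v : ∀ x ∈ frontier Ω, v x = 0
  eq_u : ∀ x ∈ Ω, -lap u x = lam * f x / (1 - v x) ^ 2
  eq_v : ∀ x ∈ Ω, -lap v x = mu * g x / (1 - u x) ^ 2

/-- A minimal solution: a classical solution lying below every classical solution. -/
def IsMinimalSolution {N : ℕ} (Ω : Set (Euc N)) (f g : Euc N → ℝ)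
    (lam mu : ℝ) (u v : Euc N → ℝ) : Prop :=
  IsClassicalSolution Ω f g lam mu u v ∧
  ∀ U V : Euc N → ℝ, IsClassicalSolution Ω f g lam mu U V →
    ∀ x ∈ Ω, u x ≤ U x ∧ v x ≤ V x

/-- The existence region `Λ`: parameter pairs in the positive quadrant for which
the system has a classical solution. -/
def LambdaSet {N : ℕ} (Ω : Set (Euc N)) (f g : Euc N → ℝ) : Set (ℝ × ℝ) :=
  {p | 0 < p.1 ∧ 0 < p.2 ∧ ∃ u v, IsClassicalSolution Ω f g p.1 p.2 u v}

/-- A solution `(u,v)` of the Hamiltonian system `-Δu = g(v)`, `-Δv = f(u)` is stable if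
the first eigenvalue `ν₁` of the linearized operator
`𝔏(φ₁,φ₂) = (-Δφ₁ - g′(v)φ₂, -Δφ₂ - f′(u)φ₁)` (Dirichlet conditions) is positive, i.e.
there is a positive eigenvalue with a positive eigenfunction pair. -/
def IsStableHamiltonian {N : ℕ} (Ω : Set (Euc N)) (f g : ℝ → ℝ)
    (u v : Euc N → ℝ) : Prop :=
  ∃ ν₁ : ℝ, 0 < ν₁ ∧ ∃ φ₁ φ₂ : Euc N → ℝ,
    ContDiffOn ℝ 2 φ₁ Ω ∧ ContDiffOn ℝ 2 φ₂ Ω ∧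
    ContinuousOn φ₁ (closure Ω) ∧ ContinuousOn φ₂ (closure Ω) ∧
    (∀ x ∈ Ω, 0 < φ₁ x) ∧ (∀ x ∈ Ω, 0 < φ₂ x) ∧
    (∀ x ∈ frontier Ω, φ₁ x = 0) ∧ (∀ x ∈ frontier Ω, φ₂ x = 0) ∧
    (∀ x ∈ Ω, -lap φ₁ x - deriv g (v x) * φ₂ x = ν₁ * φ₁ x) ∧
    (∀ x ∈ Ω, -lap φ₂ x - deriv f (u x) * φ₁ x = ν₁ * φ₂ x)

theorem norm_fderiv_sq_ge {N : ℕ} (L : Euc N →L[ℝ] ℝ) :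
    ∑ i : Fin N, (L (EuclideanSpace.single i (1:ℝ))) ^ 2 ≤ ‖L‖ ^ 2 := by
  obtain ⟨y, rfl⟩ := (InnerProductSpace.toDual ℝ (Euc N)).surjective L
  rw [LinearIsometryEquiv.norm_map, EuclideanSpace.norm_sq_eq]
  apply le_of_eq
  refine Finset.sum_congr rfl fun i _ => ?_
  simp [InnerProductSpace.toDual_apply_apply, EuclideanSpace.inner_single_right]

theorem integral_fderiv_zero_aux {N : ℕ} (ψ : Euc N → ℝ) (h : ContDiff ℝ 1 ψ)
    (hc : HasCompactSupport ψ) (e : Euc N) :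
    Integrable (fun x => fderiv ℝ ψ x e) ∧ ∫ x, fderiv ℝ ψ x e = 0 := by
  have hcont : Continuous (fun x => fderiv ℝ ψ x e) :=
    (h.continuous_fderiv (by norm_num)).clm_apply continuous_const
  have hcs : HasCompactSupport (fun x => fderiv ℝ ψ x e) := hc.fderiv_apply ℝ e
  have hi := hcont.integrable_of_hasCompactSupport (μ := volume) hcs
  refine ⟨hi, ?_⟩
  have := integral_mul_fderiv_eq_neg_fderiv_mul_of_integrable (μ := (volume : Measure (Euc N)))
    (f := fun _ => (1:ℝ)) (g := ψ) (v := e) (by simp) (by simpa using hi)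
    (by simpa using h.continuous.integrable_of_hasCompactSupport hc)
    (fun x _ => by fun_prop) (fun x _ => h.differentiable (by norm_num) x)
  simpa using this

theorem picone_aux {N : ℕ} (Ω : Set (Euc N)) (hΩ : IsOpen Ω) (a : Euc N → ℝ)
    (ha : ContDiffOn ℝ 2 a Ω) (hpos : ∀ x ∈ Ω, 0 < a x)
    (φ : Euc N → ℝ) (hφ : ContDiff ℝ 1 φ) (hc : HasCompactSupport φ) (hs : tsupport φ ⊆ Ω) :
    ∃ D : Euc N → ℝ, Integrable D ∧ ∫ x in Ω, D x = 0 ∧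
      ∀ x ∈ Ω, D x ≤ ‖fderiv ℝ φ x‖ ^ 2 + φ x ^ 2 * (lap a x / a x) := by
  let e : Fin N → Euc N := fun i => EuclideanSpace.single i (1:ℝ)
  let q : Fin N → Euc N → ℝ := fun i x => fderiv ℝ a x (e i)
  let ψ : Fin N → Euc N → ℝ := fun i x => φ x ^ 2 * (q i x / a x)
  have haat : ∀ x ∈ Ω, ContDiffAt ℝ 2 a x := fun x hx => ha.contDiffAt (hΩ.mem_nhds hx)
  have hq : ∀ i, ∀ x ∈ Ω, ContDiffAt ℝ 1 (q i) x := fun i x hx =>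
    ((haat x hx).fderiv_right (m := 1) (by norm_num)).clm_apply contDiffAt_const
  have hψ : ∀ i, ContDiff ℝ 1 (ψ i) := by
    intro i
    rw [contDiff_iff_contDiffAt]
    intro x
    by_cases hx : x ∈ tsupport φ
    · have hx' := hs hx
      exact (hφ.contDiffAt.pow 2).mul
        ((hq i x hx').div ((haat x hx').of_le (by norm_num)) (hpos x hx').ne')
    · have h0 : φ =ᶠ[𝓝 x] 0 := notMem_tsupport_iff_eventuallyEq.1 hx
      refine (contDiffAt_const (c := (0:ℝ))).congr_of_eventuallyEq ?_
      filter_upwards [h0] with y hy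
      simp [ψ, hy]
  have hψc : ∀ i, HasCompactSupport (ψ i) := by
    intro i
    refine hc.mono ?_
    intro x hx hx0
    exact hx (by simp [ψ, hx0])
  have key := fun i => integral_fderiv_zero_aux (ψ i) (hψ i) (hψc i) (e i)
  refine ⟨fun x => ∑ i, fderiv ℝ (ψ i) x (e i), integrable_finsetSum _ fun i _ => (key i).1, ?_, ?_⟩
  · rw [setIntegral_eq_integral_of_forall_compl_eq_zero]
    rotate_left
    · intro x hx
      refine Finset.sum_eq_zero fun i _ => ?_
      have h0 : φ =ᶠ[𝓝 x] 0 := notMem_tsupport_iff_eventuallyEq.1 fun h => hx (hs h)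
      have h1 : ψ i =ᶠ[𝓝 x] fun _ => 0 := by
        filter_upwards [h0] with y hy
        simp [ψ, hy]
      rw [h1.fderiv_eq]
      simp
    rw [integral_finsetSum _ fun i _ => (key i).1]
    exact Finset.sum_eq_zero fun i _ => (key i).2
  · intro x hx
    have hax := hpos x hx
    have hterm : ∀ i, fderiv ℝ (ψ i) x (e i) ≤
        (fderiv ℝ φ x (e i)) ^ 2 + φ x ^ 2 * (secondDerivCoord a i x / a x) := by
      intro i
      have hqd : DifferentiableAt ℝ (q i) x := (hq i x hx).differentiableAt (by norm_num)
      have h2 : secondDerivCoord a i x = fderiv ℝ (q i) x (e i) :=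
        hqd.lineDeriv_eq_fderiv (v := e i)
      have l1 : HasLineDerivAt ℝ φ (fderiv ℝ φ x (e i)) x (e i) :=
        ((hφ.differentiable (by norm_num)) x).hasFDerivAt.hasLineDerivAt _
      have l2 : HasLineDerivAt ℝ (q i) (fderiv ℝ (q i) x (e i)) x (e i) :=
        hqd.hasFDerivAt.hasLineDerivAt _
      have l3 : HasLineDerivAt ℝ a (q i x) x (e i) :=
        ((haat x hx).differentiableAt (by norm_num)).hasFDerivAt.hasLineDerivAt _
      have l4 : HasLineDerivAt ℝ (ψ i) (fderiv ℝ (ψ i) x (e i)) x (e i) :=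
        (((hψ i).differentiable (by norm_num)) x).hasFDerivAt.hasLineDerivAt _
      unfold HasLineDerivAt at l1 l2 l3 l4
      have l5 := (l1.pow 2).mul (l2.div l3 (by simpa using hax.ne'))
      have h3 := l4.unique l5
      simp only [zero_smul, add_zero] at h3
      rw [h2]
      have : fderiv ℝ (ψ i) x (e i) = (fderiv ℝ φ x (e i)) ^ 2
          + φ x ^ 2 * (fderiv ℝ (q i) x (e i) / a x)
          - (fderiv ℝ φ x (e i) - φ x * q i x / a x) ^ 2 := by
        rw [h3]
        simp
        field_simp
        ring
      rw [this]
      nlinarith [sq_nonneg (fderiv ℝ φ x (e i) - φ x * q i x / a x)]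
    calc _ ≤ ∑ i, ((fderiv ℝ φ x (e i)) ^ 2 + φ x ^ 2 * (secondDerivCoord a i x / a x)) :=
          Finset.sum_le_sum fun i _ => hterm i
      _ = ∑ i, (fderiv ℝ φ x (e i)) ^ 2 + φ x ^ 2 * (lap a x / a x) := by
          rw [Finset.sum_add_distrib, ← Finset.mul_sum, ← Finset.sum_div]; rfl
      _ ≤ _ := by
          gcongr
          exact norm_fderiv_sq_ge _

theorem sqrt_amgm_aux (p q a b : ℝ) (hp : 0 ≤ p) (hq : 0 ≤ q) (ha : 0 < a) (hb : 0 < b) :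
    2 * Real.sqrt (p * q) ≤ q * b / a + p * a / b := by
  have h1 : p * q = (p * a / b) * (q * b / a) := by field_simp
  have hx : 0 ≤ p * a / b := by positivity
  have hy : 0 ≤ q * b / a := by positivity
  rw [h1, Real.sqrt_mul hx]
  nlinarith [sq_nonneg (Real.sqrt (p * a / b) - Real.sqrt (q * b / a)), Real.sq_sqrt hx,
    Real.sq_sqrt hy]

/-- **Lemma (stability inequality).** For a stable solution of the Hamiltonian system
`-Δu = g(v)`, `-Δv = f(u)` with `f, g` nondecreasing and `C¹`, one has
`∫_Ω √(f′(u)g′(v)) φ² ≤ ∫_Ω |∇φ|²` for all `φ ∈ C_c¹(Ω)`. -/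
theorem statement16 {N : ℕ} (hN : 1 ≤ N) (Ω : Set (Euc N)) (hΩ : IsBddDomain Ω)
    (f g : ℝ → ℝ) (hfC : ContDiff ℝ 1 f) (hgC : ContDiff ℝ 1 g)
    (hfmono : Monotone f) (hgmono : Monotone g)
    (u v : Euc N → ℝ)
    (hu : ContDiffOn ℝ 2 u (closure Ω)) (hv : ContDiffOn ℝ 2 v (closure Ω))
    (hub : ∀ x ∈ frontier Ω, u x = 0) (hvb : ∀ x ∈ frontier Ω, v x = 0)
    (hequ : ∀ x ∈ Ω, -lap u x = g (v x)) (heqv : ∀ x ∈ Ω, -lap v x = f (u x))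
    (hstable : IsStableHamiltonian Ω f g u v) :
    ∀ φ : Euc N → ℝ, ContDiff ℝ 1 φ → HasCompactSupport φ → tsupport φ ⊆ Ω →
      ∫ x in Ω, Real.sqrt (deriv f (u x) * deriv g (v x)) * φ x ^ 2 ≤
        ∫ x in Ω, ‖fderiv ℝ φ x‖ ^ 2 := by
  intro φ hφ hc hs
  obtain ⟨ν, hν, a, b, ha, hb, -, -, hap, hbp, -, -, hea, heb⟩ := hstable
  obtain ⟨hO, -, -⟩ := hΩ
  obtain ⟨D, hDi, hD0, hD⟩ := picone_aux Ω hO a ha hap φ hφ hc hs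
  obtain ⟨E, hEi, hE0, hE⟩ := picone_aux Ω hO b hb hbp φ hφ hc hs
  have hGi : Integrable (fun x => ‖fderiv ℝ φ x‖ ^ 2) := by
    refine Continuous.integrable_of_hasCompactSupport
      ((hφ.continuous_fderiv (by norm_num)).norm.pow 2) ?_
    refine (hc.fderiv ℝ).mono ?_
    intro x hx hx0
    exact hx (by simp [hx0])
  have hDE : Integrable (fun x => (1/2 : ℝ) * (D x + E x)) := (hDi.add hEi).const_mul (1/2)
  have hfin : ∫ x in Ω, (‖fderiv ℝ φ x‖ ^ 2 - (1/2) * (D x + E x))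
      = ∫ x in Ω, ‖fderiv ℝ φ x‖ ^ 2 := by
    rw [integral_sub hGi.integrableOn hDE.integrableOn,
      integral_const_mul, integral_add hDi.integrableOn hEi.integrableOn, hD0, hE0]
    simp
  rw [← hfin]
  refine integral_mono_of_nonneg (Eventually.of_forall fun x => by positivity)
    (hGi.sub hDE).integrableOn ?_
  filter_upwards [ae_restrict_mem hO.measurableSet] with x hx
  have h1 := hD x hx
  have h2 := hE x hx
  have hax := hap x hx
  have hbx := hbp x hx
  have h3 := sqrt_amgm_aux (deriv f (u x)) (deriv g (v x)) (a x) (b x)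
    hfmono.deriv_nonneg hgmono.deriv_nonneg hax hbx
  have h4 : lap a x / a x = - (deriv g (v x) * b x / a x) - ν := by
    field_simp
    linarith [hea x hx]
  have h5 : lap b x / b x = - (deriv f (u x) * a x / b x) - ν := by
    field_simp
    linarith [heb x hx]
  rw [h4] at h1
  rw [h5] at h2
  have h6 := mul_le_mul_of_nonneg_left h3 (sq_nonneg (φ x))
  have h7 : 0 ≤ φ x ^ 2 * ν := by positivity
  linarith
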